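/- arXiv:1503.07563 — 2 statements merged into one kernel-verified Lean document; each statement's English description precedes it below -/
import Mathlib

section
/- Let G be a finite simple graph and let k be a natural number such that every nonempty subset U of the vertex set contains a vertex having at most k neighbors inside U. Then G admits a k-orientation: there is a function assigning to each edge one of its two endpoints (its responsible vertex) such that every vertex is responsible for at most k edges. -/
/-- If every nonempty `U` contains a vertex with at most `k` neighbors in `U`, then for each `U`
the edges can be oriented so that every vertex is responsible for at most `k` of its edges
towards `U`. -/
theorem exists_orientation_towards {V : Type*} [DecidableEq V]
    (G : SimpleGraph V) [DecidableRel G.Adj] (k : ℕ)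
    (hdeg : ∀ U : Finset V, U.Nonempty →
      ∃ u ∈ U, (U.filter (fun v => G.Adj u v)).card ≤ k) (U : Finset V) :
    ∃ orient : Sym2 V → V,
      (∀ e, orient e ∈ e) ∧
      (∀ v : V, (U.filter fun w => G.Adj v w ∧ orient s(v, w) = v).card ≤ k) := by
  induction U using Finset.strongInduction with
  | H U ih =>
    obtain rfl | hU := U.eq_empty_or_nonempty
    · exact ⟨fun e => e.out.1, fun e => e.out_fst_mem, by simp⟩
    obtain ⟨u, hu, hcard⟩ := hdeg U hU
    obtain ⟨orient, hmem, hle⟩ := ih (U.erase u) (Finset.erase_ssubset hu)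
    refine ⟨fun e => if u ∈ e then u else orient e, fun e => ?_, fun v => ?_⟩
    · dsimp only
      split_ifs with h
      exacts [h, hmem e]
    obtain rfl | hv := eq_or_ne v u
    · refine (Finset.card_le_card fun w hw => ?_).trans hcard
      simp only [Finset.mem_filter] at hw ⊢
      exact ⟨hw.1, hw.2.1⟩
    · refine (Finset.card_le_card fun w hw => ?_).trans (hle v)
      simp only [Finset.mem_filter, Finset.mem_erase, Sym2.mem_iff] at hw ⊢
      grind


/-- If every nonempty subset `U` of the vertex set of a finite simple
graph `G` contains a vertex with at most `k` neighbors inside `U`, then `G` admits a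
`k`-orientation: a function assigning to each edge one of its two endpoints (its
responsible vertex) such that every vertex is responsible for at most `k` edges. -/
theorem degenerate_orientation {V : Type*} [Fintype V] [DecidableEq V]
    (G : SimpleGraph V) [DecidableRel G.Adj] (k : ℕ)
    (hdeg : ∀ U : Finset V, U.Nonempty →
      ∃ u ∈ U, (U.filter (fun v => G.Adj u v)).card ≤ k) :
    ∃ orient : Sym2 V → V,
      (∀ e ∈ G.edgeFinset, orient e ∈ e) ∧
      (∀ v : V, (G.edgeFinset.filter fun e => orient e = v).card ≤ k) := by
  obtain ⟨orient, hmem, hle⟩ := exists_orientation_towards G k hdeg Finset.univ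
  refine ⟨orient, fun e _ => hmem e, fun v => ?_⟩
  refine (Finset.card_le_card fun e he => ?_).trans
    ((Finset.card_image_le (f := fun w => s(v, w))).trans (hle v))
  obtain ⟨he, hv⟩ := Finset.mem_filter.mp he
  obtain ⟨w, rfl⟩ : v ∈ e := hv ▸ hmem e
  exact Finset.mem_image_of_mem _ (by simpa [hv] using he)
end

section
/- Let V be a finite set, r ∈ V, and parent : V → V a rooted-tree structure with root r, i.e. parent(r) = r and for every v ∈ V there is some n with parentⁿ(v) = r. Let w : V → ℕ satisfy w(v) ≥ 1 for all v, let W = Σ_{v ∈ V} w(v), and let s ≥ 1 be an integer. Then there exists a set S ⊆ V of special vertices with r ∈ S and |S| ≤ W/s + 1, such that for every vertex v ∉ S, the sum of w over the vertices parent⁰(v), parent¹(v), parent²(v), …, taken up to but not including the first iterate of parent applied to v that lies in S, is less than s. -/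
/-- On a rooted tree, the total weight of the path from a vertex to (but excluding) the root. -/
theorem exists_weighted_depth {V : Type*} (r : V) (parent : V → V)
    (hreach : ∀ v : V, ∃ n : ℕ, parent^[n] v = r) (w : V → ℕ) :
    ∃ D : V → ℕ, ∀ v, v ≠ r → D v = w v + D (parent v) := by
  classical
  refine ⟨fun v => ∑ i ∈ Finset.range (Nat.find (hreach v)), w (parent^[i] v), fun v hv => ?_⟩
  have hfind : Nat.find (hreach v) = Nat.find (hreach (parent v)) + 1 :=
    Nat.find_comp_succ (hreach v) (hreach (parent v)) hv
  simp only [hfind, Finset.sum_range_succ', Function.iterate_succ_apply, Function.iterate_zero_apply]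
  exact add_comm _ _

/-- Every window of `s` consecutive naturals meets every residue class modulo `s`. -/
theorem exists_mem_Ioc_mod_eq {s c : ℕ} (hc : c < s) (a : ℕ) :
    ∃ x ∈ Finset.Ioc a (a + s), x % s = c := by
  have ha := Nat.div_add_mod a s
  have hlt := Nat.mod_lt a (Nat.zero_lt_of_lt hc)
  by_cases h : a % s < c
  · refine ⟨c + s * (a / s), Finset.mem_Ioc.2 ⟨by lia, by lia⟩, ?_⟩
    rw [Nat.add_mul_mod_self_left, Nat.mod_eq_of_lt hc]
  · refine ⟨c + s * (a / s) + s, Finset.mem_Ioc.2 ⟨by lia, by lia⟩, ?_⟩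
    rw [Nat.add_mod_right, Nat.add_mul_mod_self_left, Nat.mod_eq_of_lt hc]

/-- If each `v` meets at most `w v` of `s` classes, some class is met by at most the average
number of vertices. -/
theorem exists_mul_card_filter_le_sum {V : Type*} [Fintype V] (w : V → ℕ) {s : ℕ} (hs : 1 ≤ s)
    (C : V → Finset ℕ) (hC : ∀ v, (C v).card ≤ w v) :
    ∃ c < s, s * (Finset.univ.filter fun v => c ∈ C v).card ≤ ∑ v, w v := by
  by_contra! h
  have hcount : ∑ c ∈ Finset.range s, (Finset.univ.filter fun v => c ∈ C v).card ≤ ∑ v, w v := by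
    have := Finset.sum_card_bipartiteAbove_eq_sum_card_bipartiteBelow
      (s := Finset.range s) (t := Finset.univ) (fun c v => c ∈ C v)
    simp only [Finset.bipartiteAbove, Finset.bipartiteBelow] at this
    rw [this]
    refine Finset.sum_le_sum fun v _ => (Finset.card_le_card fun c hc => ?_).trans (hC v)
    exact (Finset.mem_filter.1 hc).2
  have hlt : ∑ _c ∈ Finset.range s, ∑ v, w v
      < ∑ c ∈ Finset.range s, s * (Finset.univ.filter fun v => c ∈ C v).card :=
    Finset.sum_lt_sum_of_nonempty (Finset.nonempty_range_iff.2 (by lia))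
      fun c hc => h c (Finset.mem_range.1 hc)
  rw [← Finset.mul_sum, Finset.sum_const, Finset.card_range, smul_eq_mul] at hlt
  exact absurd (Nat.mul_le_mul_left s hcount) (not_le.2 hlt)


/-- Let `parent : V → V` encode a rooted tree on a finite vertex set
`V` with root `r` (so `parent r = r` and every vertex reaches `r` by iterating
`parent`), let `w : V → ℕ` be a weight function with `w v ≥ 1` for all `v`, let
`W = Σ_v w v`, and let `s ≥ 1`. Then there is a set `S` of special vertices containing
`r` with `|S| ≤ W/s + 1` such that for every `v ∉ S`, the sum of `w` over the iterates
`parent⁰ v, parent¹ v, …`, taken up to but not including the first iterate lying in `S`,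
is less than `s`. -/
theorem tree_peeling {V : Type*} [Fintype V] [DecidableEq V]
    (r : V) (parent : V → V) (hroot : parent r = r)
    (hreach : ∀ v : V, ∃ n : ℕ, parent^[n] v = r)
    (w : V → ℕ) (hw : ∀ v : V, 1 ≤ w v) (s : ℕ) (hs : 1 ≤ s) :
    ∃ S : Finset V, r ∈ S ∧
      ((S.card : ℝ) ≤ ((∑ v : V, w v : ℕ) : ℝ) / (s : ℝ) + 1) ∧
      (∀ v ∉ S, ∀ n : ℕ, parent^[n] v ∈ S → (∀ k < n, parent^[k] v ∉ S) →
        (∑ i ∈ Finset.range n, w (parent^[i] v)) < s) := by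
  obtain ⟨D, hD⟩ := exists_weighted_depth r parent hreach w
  let C : V → Finset ℕ := fun v =>
    (Finset.Ioc (D (parent v)) (D (parent v) + w v)).image (· % s)
  obtain ⟨c, hcs, hc⟩ := exists_mul_card_filter_le_sum w hs C fun v =>
    Finset.card_image_le.trans (by simp)
  refine ⟨insert r (Finset.univ.filter fun v => c ∈ C v), Finset.mem_insert_self _ _, ?_, ?_⟩
  · have hcard := Finset.card_insert_le r (Finset.univ.filter fun v => c ∈ C v)
    have hs0 : (0 : ℝ) < s := by exact_mod_cast hs
    have hdiv : ((Finset.univ.filter fun v => c ∈ C v).card : ℝ)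
        ≤ ((∑ v : V, w v : ℕ) : ℝ) / (s : ℝ) := by
      rw [le_div_iff₀ hs0, mul_comm]
      exact_mod_cast hc
    calc _ ≤ ((Finset.univ.filter fun v => c ∈ C v).card : ℝ) + 1 := by exact_mod_cast hcard
      _ ≤ _ := by gcongr
  · intro v _ n _ hn
    have havoid : ∀ m ≤ n, D v = (∑ i ∈ Finset.range m, w (parent^[i] v)) + D (parent^[m] v) ∧
        ∀ x ∈ Finset.Ioc (D (parent^[m] v)) (D v), x % s ≠ c := by
      intro m
      induction m with
      | zero => simp
      | succ m ih =>
        intro hm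
        obtain ⟨hsum, hmod⟩ := ih (by lia)
        have hmS := hn m hm
        simp only [Finset.mem_insert, Finset.mem_filter, Finset.mem_univ, true_and,
          not_or] at hmS
        have hstep := hD _ hmS.1
        rw [Finset.sum_range_succ, Function.iterate_succ_apply']
        refine ⟨by lia, fun x hx hxc => ?_⟩
        rw [Finset.mem_Ioc] at hx
        by_cases hxm : x ≤ D (parent^[m] v)
        · exact hmS.2 (Finset.mem_image.2 ⟨x, Finset.mem_Ioc.2 ⟨hx.1, by lia⟩, hxc⟩)
        · exact hmod x (Finset.mem_Ioc.2 ⟨by lia, hx.2⟩) hxc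
    obtain ⟨hsum, hmod⟩ := havoid n le_rfl
    by_contra! hle
    obtain ⟨x, hx, hxc⟩ := exists_mem_Ioc_mod_eq hcs (D (parent^[n] v))
    exact hmod x (Finset.Ioc_subset_Ioc_right (by lia) hx) hxc
end
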